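/- Littlewood's identity: Σ_λ s_λ(q_1,...,q_n) = 1 / (∏_{i=1}^n (1 - q_i) · ∏_{1 ≤ i < j ≤ n} (1 - q_i q_j)), where the sum is over all partitions λ with at most n parts. -/

import Mathlib

open scoped Classical

noncomputable section

/-- Cells of the Young diagram of `f : Fin r → ℕ` (viewed as a partition with at most
`r` parts, row `i` having length `f i`). -/
def pcells {r : ℕ} (f : Fin r → ℕ) : Finset (Fin r × ℕ) :=
  (Finset.univ ×ˢ Finset.range (Finset.univ.sup f)).filter (fun p => p.2 < f p.1)

/-- `T` is a semistandard filling of the diagram of `f` with entries in `Fin n`: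
rows weakly increase, columns strictly increase. -/
def IsSSYT {r n : ℕ} (f : Fin r → ℕ) (T : {x // x ∈ pcells f} → Fin n) : Prop :=
  (∀ p q : {x // x ∈ pcells f},
      p.val.1 = q.val.1 → p.val.2 ≤ q.val.2 → T p ≤ T q) ∧
  (∀ p q : {x // x ∈ pcells f},
      p.val.2 = q.val.2 → p.val.1 < q.val.1 → T p < T q)

/-- The Schur polynomial `s_f(x_1, …, x_n)`, defined combinatorially as the sum over
semistandard Young tableaux of shape `f` with entries in `{1, …, n}` of their weights. -/
def schurPoly {r : ℕ} (f : Fin r → ℕ) (n : ℕ) : MvPolynomial (Fin n) ℤ :=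
  ∑ T ∈ Finset.univ.filter (fun T : {x // x ∈ pcells f} → Fin n => IsSSYT f T),
    ∏ c : {x // x ∈ pcells f}, MvPolynomial.X (T c)

/-- The `j`-th part (`j` counted from `0`) of the conjugate of the partition `f`. -/
def conjPart {r : ℕ} (f : Fin r → ℕ) (j : ℕ) : ℕ :=
  (Finset.univ.filter (fun i => j < f i)).card

/-- The finset of partitions with at most `n` parts and size at most `m`. -/
def partitionsLE (n m : ℕ) : Finset (Fin n → ℕ) :=
  (Fintype.piFinset fun _ => Finset.range (m + 1)).filter
    (fun f => (∀ i j : Fin n, i ≤ j → f j ≤ f i) ∧ ∑ i, f i ≤ m)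

/-- `m` interlaces `l`: `l 0 ≥ m 0 ≥ l 1 ≥ m 1 ≥ ⋯ ≥ m (n - 1) ≥ l n`. -/
def Interlaces {n : ℕ} (l : Fin (n + 1) → ℕ) (m : Fin n → ℕ) : Prop :=
  ∀ i, l i.succ ≤ m i ∧ m i ≤ l i.castSucc

/-- The functions `Fin n → ℕ` with sum less than `N`. -/
def box (n N : ℕ) : Finset (Fin n → ℕ) :=
  (Fintype.piFinset fun _ => Finset.range N).filter fun f => ∑ i, f i < N

theorem mem_box {n N : ℕ} {f : Fin n → ℕ} : f ∈ box n N ↔ ∑ i, f i < N := by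
  simp only [box, Finset.mem_filter, Fintype.mem_piFinset, Finset.mem_range,
    and_iff_right_iff_imp]
  intro h i
  exact lt_of_le_of_lt (Finset.single_le_sum (f := f) (fun _ _ => Nat.zero_le _)
    (Finset.mem_univ i)) h

/-- The functions `Fin n → ℕ` with sum `m`. -/
def compositions (n m : ℕ) : Finset (Fin n → ℕ) :=
  (box n (m + 1)).filter fun f => ∑ i, f i = m

theorem mem_compositions {n m : ℕ} {f : Fin n → ℕ} :
    f ∈ compositions n m ↔ ∑ i, f i = m := by
  simp only [compositions, Finset.mem_filter, mem_box, and_iff_right_iff_imp]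
  omega

theorem filter_box {n m N : ℕ} (h : m < N) :
    (box n N).filter (fun f => ∑ i, f i = m) = compositions n m := by
  ext f
  simp only [Finset.mem_filter, mem_box, mem_compositions, and_iff_right_iff_imp]
  omega

theorem Interlaces.sum_le {n : ℕ} {l : Fin (n + 1) → ℕ} {m : Fin n → ℕ} (h : Interlaces l m) :
    ∑ i, m i ≤ ∑ i, l i := by
  rw [Fin.sum_univ_castSucc l]
  exact le_add_right (Finset.sum_le_sum fun i _ => (h i).2)

theorem interlaces_snoc_zero_iff {n : ℕ} {b k : Fin n → ℕ} :
    Interlaces (Fin.snoc b 0 : Fin (n + 1) → ℕ) k ↔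
      ∀ i, (Fin.snoc b 0 : Fin (n + 1) → ℕ) i.succ ≤ k i ∧ k i ≤ b i := by
  simp [Interlaces, Fin.snoc_castSucc (α := fun _ => ℕ)]

theorem interlaces_snoc_zero_iff_succ {n : ℕ} {v a : Fin (n + 1) → ℕ} :
    Interlaces (Fin.snoc v 0 : Fin (n + 2) → ℕ) a ↔
      (∀ i, a i ≤ v i) ∧ ∀ i : Fin n, v i.succ ≤ a i.castSucc := by
  have hs : ∀ i : Fin n, (Fin.snoc v 0 : Fin (n + 2) → ℕ) i.castSucc.succ = v i.succ :=
    fun i => Fin.snoc_castSucc (α := fun _ => ℕ) 0 v i.succ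
  have hl : (Fin.snoc v 0 : Fin (n + 2) → ℕ) (Fin.last n).succ = 0 :=
    Fin.snoc_last (α := fun _ => ℕ) 0 v
  rw [interlaces_snoc_zero_iff, forall_and, and_comm, Fin.forall_fin_succ' (P := fun i => _ ≤ a i)]
  simp only [hs, hl, Nat.zero_le, and_true]

theorem sum_snoc_zero {n : ℕ} (b : Fin n → ℕ) :
    ∑ i, (Fin.snoc b 0 : Fin (n + 1) → ℕ) i = ∑ i, b i := by
  simp [Fin.sum_univ_castSucc, Fin.snoc_castSucc (α := fun _ => ℕ), Fin.snoc_last (α := fun _ => ℕ)]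

theorem Interlaces.sum_le_snoc {n : ℕ} {b k : Fin n → ℕ}
    (h : Interlaces (Fin.snoc b 0 : Fin (n + 1) → ℕ) k) : ∑ i, k i ≤ ∑ i, b i := by
  simpa [sum_snoc_zero] using h.sum_le

/-- The sequences of sum `m` that are interlaced by both `a` and `b`. -/
def upSet {n : ℕ} (a : Fin (n + 1) → ℕ) (b : Fin n → ℕ) (m : ℕ) : Finset (Fin (n + 1) → ℕ) :=
  (compositions (n + 1) m).filter fun v =>
    Interlaces (Fin.snoc v 0 : Fin (n + 2) → ℕ) a ∧ Interlaces v b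

/-- The sequences that interlace both `a` and `b`. -/
def downSet {n : ℕ} (a : Fin (n + 1) → ℕ) (b : Fin n → ℕ) : Finset (Fin n → ℕ) :=
  Fintype.piFinset fun i =>
    Finset.Icc (max (a i.succ) ((Fin.snoc b 0 : Fin (n + 1) → ℕ) i.succ))
      (min (a i.castSucc) (b i))

theorem mem_downSet {n : ℕ} {a : Fin (n + 1) → ℕ} {b k : Fin n → ℕ} :
    k ∈ downSet a b ↔ Interlaces a k ∧ Interlaces (Fin.snoc b 0 : Fin (n + 1) → ℕ) k := by
  rw [interlaces_snoc_zero_iff]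
  simp only [downSet, Interlaces, Fintype.mem_piFinset, Finset.mem_Icc, max_le_iff, le_min_iff,
    ← forall_and]
  exact forall_congr' fun i => by tauto

theorem mem_upSet {n : ℕ} {a : Fin (n + 1) → ℕ} {b : Fin n → ℕ} {m : ℕ} {v : Fin (n + 1) → ℕ} :
    v ∈ upSet a b m ↔ max (a 0) ((Fin.snoc b 0 : Fin (n + 1) → ℕ) 0) ≤ v 0 ∧
      Fin.tail v ∈ downSet a b ∧ v 0 + ∑ i, Fin.tail v i = m := by
  have hb : (∀ i : Fin n, b i ≤ v i.castSucc) ↔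
      ∀ i, (Fin.snoc b 0 : Fin (n + 1) → ℕ) i ≤ v i := by
    rw [Fin.forall_fin_succ']
    simp [Fin.snoc_castSucc (α := fun _ => ℕ), Fin.snoc_last (α := fun _ => ℕ)]
  have hI : Interlaces v b ↔ (∀ i : Fin n, v i.succ ≤ b i) ∧
      ∀ i, (Fin.snoc b 0 : Fin (n + 1) → ℕ) i ≤ v i := by
    rw [← hb, ← forall_and]; rfl
  rw [upSet, Finset.mem_filter, mem_compositions, interlaces_snoc_zero_iff_succ, hI,
    Fin.sum_univ_succ, Fin.forall_fin_succ (P := fun i => a i ≤ v i),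
    Fin.forall_fin_succ (P := fun i => (Fin.snoc b 0 : Fin (n + 1) → ℕ) i ≤ v i)]
  simp only [downSet, Fintype.mem_piFinset, Finset.mem_Icc, max_le_iff, le_min_iff, Fin.tail,
    forall_and]
  tauto

theorem card_upSet {n : ℕ} (a : Fin (n + 1) → ℕ) (b : Fin n → ℕ) (m : ℕ) :
    (upSet a b m).card = ((downSet a b).filter fun k =>
      max (a 0) ((Fin.snoc b 0 : Fin (n + 1) → ℕ) 0) + ∑ i, k i ≤ m).card := by
  refine Finset.card_nbij' (fun v => Fin.tail v) (fun k => Fin.cons (m - ∑ i, k i) k) ?_ ?_ ?_ ?_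
  · intro v hv
    simp only [Finset.mem_coe, mem_upSet, Finset.mem_filter] at hv ⊢
    exact ⟨hv.2.1, by omega⟩
  · intro k hk
    simp only [Finset.mem_coe, mem_upSet, Finset.mem_filter, Fin.tail_cons, Fin.cons_zero] at hk ⊢
    exact ⟨by omega, hk.1, by omega⟩
  · intro v hv
    simp only [Finset.mem_coe, mem_upSet] at hv
    dsimp only
    rw [show m - ∑ i, Fin.tail v i = v 0 by omega, Fin.cons_self_tail]
  · intro k _
    exact Fin.tail_cons (α := fun _ => ℕ) _ _

theorem sum_max_add_sum_min {n : ℕ} (a : Fin (n + 1) → ℕ) (b : Fin n → ℕ) :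
    max (a 0) ((Fin.snoc b 0 : Fin (n + 1) → ℕ) 0) +
      (∑ i : Fin n, max (a i.succ) ((Fin.snoc b 0 : Fin (n + 1) → ℕ) i.succ) +
        ∑ i : Fin n, min (a i.castSucc) (b i)) = ∑ i, a i + ∑ i, b i := by
  rw [← add_assoc, ← Fin.sum_univ_succ
    (f := fun i => max (a i) ((Fin.snoc b 0 : Fin (n + 1) → ℕ) i)), ← sum_snoc_zero b,
    ← Finset.sum_add_distrib]
  have : ∑ i : Fin n, min (a i.castSucc) (b i) =
      ∑ i, min (a i) ((Fin.snoc b 0 : Fin (n + 1) → ℕ) i) := by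
    simp [Fin.sum_univ_castSucc, Fin.snoc_castSucc (α := fun _ => ℕ),
      Fin.snoc_last (α := fun _ => ℕ)]
  rw [this, ← Finset.sum_add_distrib]
  exact Finset.sum_congr rfl fun i _ => max_add_min _ _

theorem card_filter_downSet {n : ℕ} (a : Fin (n + 1) → ℕ) (b : Fin n → ℕ) (s : ℕ) :
    ((downSet a b).filter fun k =>
      max (a 0) ((Fin.snoc b 0 : Fin (n + 1) → ℕ) 0) + ∑ i, k i = s).card =
    ((downSet a b).filter fun k => ∑ i, k i + s = ∑ i, a i + ∑ i, b i).card := by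
  let lo : Fin n → ℕ := fun i => max (a i.succ) ((Fin.snoc b 0 : Fin (n + 1) → ℕ) i.succ)
  let hi : Fin n → ℕ := fun i => min (a i.castSucc) (b i)
  have key : max (a 0) ((Fin.snoc b 0 : Fin (n + 1) → ℕ) 0) + (∑ i, lo i + ∑ i, hi i) =
    ∑ i, a i + ∑ i, b i := sum_max_add_sum_min a b
  have hmem : ∀ k : Fin n → ℕ, k ∈ downSet a b ↔ ∀ i, lo i ≤ k i ∧ k i ≤ hi i := by
    intro k
    simp [downSet, lo, hi]
  have hmaps : ∀ k ∈ downSet a b, (fun i => lo i + hi i - k i) ∈ downSet a b := by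
    intro k hk
    rw [hmem] at hk ⊢
    intro i
    have := hk i
    constructor <;> omega
  have hsum : ∀ k ∈ downSet a b,
      ∑ i, (lo i + hi i - k i) + ∑ i, k i = ∑ i, lo i + ∑ i, hi i := by
    intro k hk
    rw [hmem] at hk
    rw [← Finset.sum_add_distrib, ← Finset.sum_add_distrib]
    exact Finset.sum_congr rfl fun i _ => by have := hk i; omega
  have hinv : ∀ k ∈ downSet a b, (fun i => lo i + hi i - (lo i + hi i - k i)) = k := by
    intro k hk
    rw [hmem] at hk
    funext i
    have := hk i
    omega
  clear_value lo hi
  refine Finset.card_nbij' (fun k i => lo i + hi i - k i) (fun k i => lo i + hi i - k i) ?_ ?_ ?_ ?_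
  · intro k hk
    simp only [Finset.mem_coe, Finset.mem_filter] at hk ⊢
    have := hsum k hk.1
    exact ⟨hmaps k hk.1, by omega⟩
  · intro k hk
    simp only [Finset.mem_coe, Finset.mem_filter] at hk ⊢
    have := hsum k hk.1
    exact ⟨hmaps k hk.1, by omega⟩
  · intro k hk
    exact hinv k (Finset.mem_filter.1 hk).1
  · intro k hk
    exact hinv k (Finset.mem_filter.1 hk).1

theorem card_upSet_succ {n : ℕ} (a : Fin (n + 1) → ℕ) (b : Fin n → ℕ) (m : ℕ) :
    (upSet a b (m + 1)).card = (upSet a b m).card +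
      ((downSet a b).filter fun k => ∑ i, k i + (m + 1) = ∑ i, a i + ∑ i, b i).card := by
  rw [← card_filter_downSet, card_upSet, card_upSet, ← Finset.card_union_of_disjoint]
  · congr 1
    ext k
    simp only [Finset.mem_filter, Finset.mem_union]
    rw [← and_or_left, Nat.le_succ_iff]
  · rw [Finset.disjoint_filter]
    intro k _ h
    omega

theorem card_upSet_zero {n : ℕ} (a : Fin (n + 1) → ℕ) (b : Fin n → ℕ) :
    (upSet a b 0).card =
      ((downSet a b).filter fun k => ∑ i, k i + 0 = ∑ i, a i + ∑ i, b i).card := by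
  rw [← card_filter_downSet, card_upSet]
  simp only [Nat.le_zero]

theorem card_upSet_sum {n : ℕ} (a : Fin (n + 1) → ℕ) (b : Fin n → ℕ) :
    (upSet a b (∑ i, a i)).card =
      ((downSet a b).filter fun k => ∑ i, k i + ∑ i, a i = ∑ i, a i + ∑ i, b i).card := by
  rcases h : ∑ i, a i with _ | m
  · rw [card_upSet_zero, h]
  · rw [card_upSet_succ, h, Nat.add_eq_right, Finset.card_eq_zero, upSet,
      Finset.filter_eq_empty_iff]
    rintro v hv ⟨hva, -⟩
    have := hva.sum_le_snoc
    rw [mem_compositions] at hv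
    omega

section GelfandTsetlin

variable {R : Type*} [CommRing R] (x : ℕ → R)

/-- The sum of the weights of the Gelfand–Tsetlin patterns with top row `l`. It vanishes unless
`l` is a partition. -/
def patternSum : (n : ℕ) → (Fin n → ℕ) → R
  | 0, _ => 1
  | n + 1, l => ∑ m ∈ (box n (∑ i, l i + 1)).filter (Interlaces l),
      patternSum n m * x n ^ (∑ i, l i - ∑ i, m i)

/-- The complete homogeneous symmetric polynomial of degree `k` in `x 0, …, x (n - 1)`. -/
def completeHomogeneous : ℕ → ℕ → R
  | _, 0 => 1
  | 0, _ + 1 => 0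
  | n + 1, k + 1 => completeHomogeneous n (k + 1) + x n * completeHomogeneous (n + 1) k

theorem patternSum_succ {n N : ℕ} (l : Fin (n + 1) → ℕ) (h : ∑ i, l i < N) :
    patternSum x (n + 1) l = ∑ m ∈ (box n N).filter (Interlaces l),
      patternSum x n m * x n ^ (∑ i, l i - ∑ i, m i) := by
  rw [patternSum]
  refine Finset.sum_congr (Finset.ext fun m => ?_) fun _ _ => rfl
  simp only [Finset.mem_filter, mem_box]
  constructor
  · rintro ⟨_, hm⟩
    exact ⟨hm.sum_le.trans_lt h, hm⟩
  · rintro ⟨_, hm⟩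
    exact ⟨Nat.lt_succ_of_le hm.sum_le, hm⟩

theorem sum_patternSum_succ {n m N : ℕ} (hN : m < N) (P : (Fin (n + 1) → ℕ) → Prop) :
    ∑ v ∈ (compositions (n + 1) m).filter P, patternSum x (n + 1) v =
      ∑ b ∈ box n N, patternSum x n b * x n ^ (m - ∑ i, b i) *
        (((compositions (n + 1) m).filter fun v => P v ∧ Interlaces v b).card : R) := by
  have : ∀ v ∈ (compositions (n + 1) m).filter P, patternSum x (n + 1) v =
      ∑ b ∈ box n N, if Interlaces v b then patternSum x n b * x n ^ (m - ∑ i, b i) else 0 := by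
    intro v hv
    rw [Finset.mem_filter, mem_compositions] at hv
    rw [patternSum_succ x v (hv.1 ▸ hN), Finset.sum_filter, hv.1]
  rw [Finset.sum_congr rfl this, Finset.sum_comm]
  refine Finset.sum_congr rfl fun b _ => ?_
  rw [← Finset.sum_filter, Finset.sum_const, Finset.filter_filter, nsmul_eq_mul, mul_comm]

theorem sum_downSet {n N : ℕ} (a : Fin (n + 1) → ℕ) (k : ℕ) (hN : ∑ i, a i + k < N)
    (pieri : ∀ c : Fin n → ℕ, patternSum x n c * completeHomogeneous x n k =
      ∑ v ∈ (compositions n (∑ i, c i + k)).filter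
        (fun v => Interlaces (Fin.snoc v 0 : Fin (n + 1) → ℕ) c), patternSum x n v) :
    ∑ b ∈ box n N, patternSum x n b * x n ^ (∑ i, a i + k - ∑ i, b i) *
        (((downSet a b).filter fun c =>
          ∑ i, c i + (∑ i, a i + k) = ∑ i, a i + ∑ i, b i).card : R) =
      patternSum x (n + 1) a * completeHomogeneous x n k := by
  have hcard : ∀ b ∈ box n N, patternSum x n b * x n ^ (∑ i, a i + k - ∑ i, b i) *
        (((downSet a b).filter fun c =>
          ∑ i, c i + (∑ i, a i + k) = ∑ i, a i + ∑ i, b i).card : R) =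
      ∑ c ∈ (box n N).filter (Interlaces a), if ∑ i, b i = ∑ i, c i + k ∧
        Interlaces (Fin.snoc b 0 : Fin (n + 1) → ℕ) c then
          patternSum x n b * x n ^ (∑ i, a i - ∑ i, c i) else 0 := by
    intro b _
    rw [← Finset.sum_filter, Finset.filter_filter, mul_comm, ← nsmul_eq_mul, ← Finset.sum_const]
    refine Finset.sum_congr (Finset.ext fun c => ?_) fun c hc => ?_
    · simp only [Finset.mem_filter, mem_downSet, mem_box]
      constructor
      · rintro ⟨⟨h1, h2⟩, h3⟩
        have := h1.sum_le
        exact ⟨by omega, h1, by omega, h2⟩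
      · rintro ⟨h1, h2, h3, h4⟩
        exact ⟨⟨h2, h4⟩, by omega⟩
    · rw [Finset.mem_filter] at hc
      congr 2
      omega
  rw [Finset.sum_congr rfl hcard, Finset.sum_comm, patternSum_succ x a (N := N) (by omega),
    Finset.sum_mul]
  refine Finset.sum_congr rfl fun c hc => ?_
  rw [Finset.mem_filter] at hc
  have := hc.2.sum_le
  rw [← Finset.sum_filter, ← Finset.filter_filter, filter_box (by omega), ← Finset.sum_mul,
    ← pieri, mul_right_comm]

/-- Pieri's rule. -/
theorem patternSum_mul_completeHomogeneous {n : ℕ} (a : Fin n → ℕ) (k : ℕ) :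
    patternSum x n a * completeHomogeneous x n k =
      ∑ v ∈ (compositions n (∑ i, a i + k)).filter
        (fun v => Interlaces (Fin.snoc v 0 : Fin (n + 1) → ℕ) a), patternSum x n v := by
  induction n generalizing k with
  | zero =>
    rcases k with _ | k
    · rw [Finset.filter_true_of_mem fun _ _ i => i.elim0]
      simp [patternSum, completeHomogeneous, compositions, box]
    · simp [patternSum, completeHomogeneous, compositions]
  | succ n ih =>
    induction k with
    | zero =>
      rw [sum_patternSum_succ x (lt_add_one _)]
      rw [Finset.sum_congr rfl fun b _ => by
        rw [← upSet, add_zero, card_upSet_sum, ← add_zero (∑ i, a i)]]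
      have := sum_downSet x a 0 (lt_add_one _) fun c => ih c 0
      simp only [add_zero] at this ⊢
      rw [this]
      simp [completeHomogeneous]
    | succ k ihk =>
      rw [completeHomogeneous, mul_add, mul_left_comm, ihk,
        ← sum_downSet x a (k + 1) (lt_add_one _) fun c => ih c (k + 1),
        sum_patternSum_succ x (N := ∑ i, a i + (k + 1) + 1) (by omega),
        sum_patternSum_succ x (lt_add_one _), Finset.mul_sum, ← Finset.sum_add_distrib]
      refine Finset.sum_congr rfl fun b _ => ?_
      rw [← upSet, ← upSet, ← add_assoc, card_upSet_succ, Nat.cast_add, mul_add, add_comm]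
      congr 1
      rcases (upSet a b (∑ i, a i + k)).eq_empty_or_nonempty with h | ⟨v, hv⟩
      · simp [h]
      · rw [upSet, Finset.mem_filter, mem_compositions] at hv
        have := hv.2.2.sum_le
        rw [Nat.sub_add_comm (m := 1) (by omega), pow_succ]
        ring

/-- The sum of `patternSum` over all sequences of length `n` and sum `m`. -/
def totalSum (n m : ℕ) : R := ∑ l ∈ compositions n m, patternSum x n l

/-- The coefficients of `∏ i < n, 1 / (1 - x i * y * T ^ 2)`. -/
def evenCoeff (y : R) (n p : ℕ) : R :=
  if Even p then y ^ (p / 2) * completeHomogeneous x n (p / 2) else 0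

theorem totalSum_eq_sum_upSet {n m N : ℕ} (hN : m < N) :
    totalSum x (n + 1) m = ∑ b ∈ box n N, patternSum x n b * x n ^ (m - ∑ i, b i) *
      ((upSet (Fin.snoc b 0) b m).card : R) := by
  have := sum_patternSum_succ x (n := n) hN (fun _ => True)
  rw [Finset.filter_true] at this
  rw [totalSum, this]
  refine Finset.sum_congr rfl fun b _ => ?_
  congr 3
  ext v
  simp only [upSet, Finset.mem_filter, interlaces_snoc_zero_iff_succ, true_and]
  refine and_congr_right fun _ => iff_and_self.2 fun h => ?_
  simp only [Fin.forall_fin_succ', Fin.snoc_castSucc (α := fun _ => ℕ),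
    Fin.snoc_last (α := fun _ => ℕ), Nat.zero_le, and_true]
  exact ⟨fun i => (h i).2, fun i => (h i).1⟩

theorem sum_downSet_snoc (n m : ℕ) :
    ∑ b ∈ box n (m + 1), patternSum x n b * x n ^ (m - ∑ i, b i) *
      (((downSet (Fin.snoc b 0) b).filter fun c =>
        ∑ i, c i + m = ∑ i, (Fin.snoc b 0 : Fin (n + 1) → ℕ) i + ∑ i, b i).card : R) =
    ∑ p ∈ Finset.HasAntidiagonal.antidiagonal m, evenCoeff x (x n) n p.1 * totalSum x n p.2 := by
  have hcard : ∀ b ∈ box n (m + 1), patternSum x n b * x n ^ (m - ∑ i, b i) *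
      (((downSet (Fin.snoc b 0) b).filter fun c =>
        ∑ i, c i + m = ∑ i, (Fin.snoc b 0 : Fin (n + 1) → ℕ) i + ∑ i, b i).card : R) =
      ∑ c ∈ box n (m + 1), if ∑ i, c i + m = ∑ i, b i + ∑ i, b i ∧
        Interlaces (Fin.snoc b 0 : Fin (n + 1) → ℕ) c then
          patternSum x n b * x n ^ (m - ∑ i, b i) else 0 := by
    intro b hb
    rw [← Finset.sum_filter, Finset.sum_const, nsmul_eq_mul, mul_comm, sum_snoc_zero]
    congr 3
    ext c
    simp only [Finset.mem_filter, mem_downSet, and_self, mem_box]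
    rw [mem_box] at hb
    constructor
    · rintro ⟨h1, h2⟩
      exact ⟨h1.sum_le_snoc.trans_lt hb, h2, h1⟩
    · tauto
  have hinner : ∀ c ∈ box n (m + 1),
      (∑ b ∈ box n (m + 1), if ∑ i, c i + m = ∑ i, b i + ∑ i, b i ∧
        Interlaces (Fin.snoc b 0 : Fin (n + 1) → ℕ) c then
          patternSum x n b * x n ^ (m - ∑ i, b i) else 0) =
      evenCoeff x (x n) n (m - ∑ i, c i) * patternSum x n c := by
    intro c hc
    rw [mem_box] at hc
    rw [evenCoeff]
    split_ifs with he
    · obtain ⟨k, hk⟩ := he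
      rw [show (m - ∑ i, c i) / 2 = k by omega, mul_assoc, mul_comm (completeHomogeneous x n k),
        patternSum_mul_completeHomogeneous, Finset.mul_sum,
        ← filter_box (N := m + 1) (by omega), Finset.filter_filter, ← Finset.sum_filter]
      refine Finset.sum_congr (Finset.filter_congr fun b _ => ?_) fun b hb => ?_
      · exact and_congr_left fun _ => by omega
      · rw [Finset.mem_filter] at hb
        rw [mul_comm, show m - ∑ i, b i = k by omega]
    · rw [zero_mul]
      refine Finset.sum_eq_zero fun b _ => if_neg ?_
      rintro ⟨h, -⟩
      exact he ⟨m - ∑ i, b i, by omega⟩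
  rw [Finset.sum_congr rfl hcard, Finset.sum_comm, Finset.sum_congr rfl hinner,
    Finset.Nat.sum_antidiagonal_eq_sum_range_succ
      (fun p j => evenCoeff x (x n) n p * totalSum x n j),
    ← Finset.sum_range_reflect,
    ← Finset.sum_fiberwise_of_maps_to (t := Finset.range (m + 1)) (g := fun c => ∑ i, c i)
      (fun c hc => by rw [Finset.mem_range]; exact mem_box.1 hc)]
  refine Finset.sum_congr rfl fun j hj => ?_
  rw [Finset.mem_range] at hj
  rw [filter_box hj, show m - (m + 1 - 1 - j) = j by omega, totalSum, Finset.mul_sum]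
  refine Finset.sum_congr rfl fun c hc => ?_
  rw [mem_compositions] at hc
  rw [hc, Nat.succ_sub_one]

theorem totalSum_zero_right (n : ℕ) : totalSum x (n + 1) 0 =
    ∑ p ∈ Finset.HasAntidiagonal.antidiagonal 0, evenCoeff x (x n) n p.1 * totalSum x n p.2 := by
  rw [← sum_downSet_snoc, totalSum_eq_sum_upSet x zero_lt_one]
  exact Finset.sum_congr rfl fun b _ => by rw [card_upSet_zero]

theorem totalSum_succ_succ (n m : ℕ) : totalSum x (n + 1) (m + 1) =
    x n * totalSum x (n + 1) m +
      ∑ p ∈ Finset.HasAntidiagonal.antidiagonal (m + 1), evenCoeff x (x n) n p.1 * totalSum x n p.2 := by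
  rw [← sum_downSet_snoc, totalSum_eq_sum_upSet x (lt_add_one (m + 1)),
    totalSum_eq_sum_upSet x (N := m + 1 + 1) (by omega), Finset.mul_sum, ← Finset.sum_add_distrib]
  refine Finset.sum_congr rfl fun b _ => ?_
  rw [card_upSet_succ, Nat.cast_add, mul_add]
  congr 1
  rcases (upSet (Fin.snoc b 0) b m).eq_empty_or_nonempty with h | ⟨v, hv⟩
  · simp [h]
  · rw [upSet, Finset.mem_filter, mem_compositions] at hv
    have := hv.2.2.sum_le
    rw [Nat.sub_add_comm (by omega), pow_succ]
    ring

open PowerSeries in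
theorem one_sub_mul_mk_totalSum (n : ℕ) :
    (1 - C (x n) * X) * mk (totalSum x (n + 1)) =
      mk (evenCoeff x (x n) n) * mk (totalSum x n) := by
  ext m
  rw [coeff_mul (φ := mk (evenCoeff x (x n) n)), sub_mul, one_mul, map_sub, mul_assoc,
    coeff_C_mul]
  rcases m with _ | m
  · simp [totalSum_zero_right]
  · simp only [coeff_succ_X_mul, coeff_mk, totalSum_succ_succ]
    ring

open PowerSeries in
theorem one_sub_mul_mk_evenCoeff (y : R) (n : ℕ) :
    (1 - C (x n * y) * X ^ 2) * mk (evenCoeff x y (n + 1)) = mk (evenCoeff x y n) := by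
  ext m
  rw [sub_mul, one_mul, map_sub, mul_assoc, coeff_C_mul, coeff_X_pow_mul']
  simp only [coeff_mk, evenCoeff]
  rcases m with _ | _ | m
  · simp [completeHomogeneous]
  · simp
  · have h : (m + 1 + 1) / 2 = m / 2 + 1 := by omega
    simp only [h, Nat.even_add_one, not_not, Nat.add_sub_cancel, completeHomogeneous,
      Nat.le_add_left, if_true, add_assoc, Nat.reduceAdd]
    split_ifs
    · ring
    · simp

open PowerSeries in
theorem prod_mul_mk_evenCoeff (y : R) (n : ℕ) :
    (∏ i ∈ Finset.range n, (1 - C (x i * y) * X ^ 2)) * mk (evenCoeff x y n) = 1 := by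
  induction n with
  | zero =>
    ext m
    rcases m with _ | m
    · simp [evenCoeff, completeHomogeneous]
    · simp only [Finset.range_zero, Finset.prod_empty, one_mul, coeff_mk, evenCoeff, coeff_one]
      rw [if_neg m.succ_ne_zero, ite_eq_right_iff]
      rintro ⟨k, hk⟩
      obtain ⟨j, hj⟩ : ∃ j, (m + 1) / 2 = j + 1 := ⟨(m + 1) / 2 - 1, by omega⟩
      simp [hj, completeHomogeneous]
  | succ n ih => rw [Finset.prod_range_succ, mul_assoc, one_sub_mul_mk_evenCoeff, ih]

open PowerSeries in
theorem prod_mul_mk_totalSum (n : ℕ) :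
    ((∏ i ∈ Finset.range n, (1 - C (x i) * X)) *
      ∏ j ∈ Finset.range n, ∏ i ∈ Finset.range j, (1 - C (x i * x j) * X ^ 2)) *
        mk (totalSum x n) = 1 := by
  induction n with
  | zero =>
    ext m
    rcases m with _ | m
    · simp [totalSum, compositions, box, patternSum]
    · simp [totalSum, compositions, coeff_one]
  | succ n ih =>
    rw [Finset.prod_range_succ, Finset.prod_range_succ _ n]
    calc _ = ((∏ i ∈ Finset.range n, (1 - C (x i) * X)) *
          (∏ j ∈ Finset.range n, ∏ i ∈ Finset.range j, (1 - C (x i * x j) * X ^ 2))) *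
          (∏ i ∈ Finset.range n, (1 - C (x i * x n) * X ^ 2)) *
          ((1 - C (x n) * X) * mk (totalSum x (n + 1))) := by ring
      _ = _ := by
        rw [one_sub_mul_mk_totalSum, mul_assoc, ← mul_assoc (∏ i ∈ _, _) (mk _),
          prod_mul_mk_evenCoeff, one_mul, ih]

end GelfandTsetlin

section Grading

variable {σ R : Type*} [CommRing R]

/-- The ring homomorphism splitting a power series into its homogeneous components. -/
def gradingHom : MvPowerSeries σ R →+* PowerSeries (MvPowerSeries σ R) where
  toFun g := PowerSeries.mk fun m => MvPowerSeries.homogeneousComponent m g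
  map_zero' := by ext; simp
  map_add' f g := by ext; simp
  map_one' := by
    ext m d
    simp only [PowerSeries.coeff_mk, MvPowerSeries.coeff_homogeneousComponent, PowerSeries.coeff_one,
      MvPowerSeries.coeff_one]
    rcases eq_or_ne d 0 with rfl | hd
    · rcases eq_or_ne m 0 with rfl | hm
      · simp
      · simp [hm, hm.symm]
    · split_ifs <;> simp [MvPowerSeries.coeff_one, hd]
  map_mul' f g := by
    ext m d
    simp only [PowerSeries.coeff_mk, MvPowerSeries.coeff_homogeneousComponent, PowerSeries.coeff_mul,
      MvPowerSeries.coeff_mul, map_sum]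
    rw [Finset.sum_comm]
    have : ∀ p ∈ Finset.HasAntidiagonal.antidiagonal d,
        (∑ q ∈ Finset.HasAntidiagonal.antidiagonal m,
          (if p.1.degree = q.1 then MvPowerSeries.coeff p.1 f else 0) *
            if p.2.degree = q.2 then MvPowerSeries.coeff p.2 g else 0) =
          if d.degree = m then MvPowerSeries.coeff p.1 f * MvPowerSeries.coeff p.2 g else 0 := by
      intro p hp
      rw [Finset.HasAntidiagonal.mem_antidiagonal] at hp
      have hdeg : d.degree = p.1.degree + p.2.degree := by rw [← hp, map_add]
      split_ifs with h
      · rw [Finset.sum_eq_single (p.1.degree, p.2.degree)]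
        · simp
        · rintro ⟨i, j⟩ _ hij
          simp only [ne_eq, Prod.mk.injEq, not_and_or] at hij
          rcases hij with hij | hij
          · rw [if_neg (Ne.symm hij), zero_mul]
          · rw [if_neg (c := _ = j) (Ne.symm hij), mul_zero]
        · intro hn
          exact absurd (Finset.HasAntidiagonal.mem_antidiagonal.2 (hdeg.symm.trans h)) hn
      · refine Finset.sum_eq_zero ?_
        rintro ⟨i, j⟩ hq
        rw [Finset.HasAntidiagonal.mem_antidiagonal] at hq
        by_cases hi : p.1.degree = i
        · rw [if_neg (c := _ = j) (by dsimp only at hq; omega), mul_zero]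
        · rw [if_neg hi, zero_mul]
    rw [Finset.sum_congr rfl this]
    split_ifs <;> simp

theorem gradingHom_injective :
    Function.Injective (gradingHom : MvPowerSeries σ R →+* PowerSeries (MvPowerSeries σ R)) := by
  intro f g h
  ext d
  have := congrArg (fun s => MvPowerSeries.coeff d (PowerSeries.coeff d.degree s)) h
  simpa [gradingHom, MvPowerSeries.coeff_homogeneousComponent] using this

theorem gradingHom_X (i : σ) : gradingHom (MvPowerSeries.X i : MvPowerSeries σ R) =
    PowerSeries.C (MvPowerSeries.X i) * PowerSeries.X := by
  ext m d
  simp only [gradingHom, RingHom.coe_mk, MonoidHom.coe_mk, OneHom.coe_mk, PowerSeries.coeff_mk,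
    MvPowerSeries.coeff_homogeneousComponent, PowerSeries.coeff_C_mul, PowerSeries.coeff_X,
    MvPowerSeries.coeff_X]
  rcases eq_or_ne d (Finsupp.single i 1) with rfl | hd
  · by_cases hm : m = 1
    · simp [hm]
    · simp [hm, Ne.symm hm]
  · split_ifs <;> simp [MvPowerSeries.coeff_X, hd]

end Grading

theorem map_patternSum {R S : Type*} [CommRing R] [CommRing S] (φ : R →+* S) (x : ℕ → R) (n : ℕ)
    (l : Fin n → ℕ) : φ (patternSum x n l) = patternSum (fun i => φ (x i)) n l := by
  induction n with
  | zero => simp [patternSum]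
  | succ n ih => simp [patternSum, ih]

theorem isHomogeneous_patternSum {σ R : Type*} [CommRing R] {x : ℕ → MvPolynomial σ R} {n : ℕ}
    (hx : ∀ i < n, (x i).IsHomogeneous 1) (l : Fin n → ℕ) :
    (patternSum x n l).IsHomogeneous (∑ i, l i) := by
  induction n with
  | zero => simpa [patternSum] using MvPolynomial.isHomogeneous_one σ R
  | succ n ih =>
    refine MvPolynomial.IsHomogeneous.sum _ _ _ fun m hm => ?_
    have hle := (Finset.mem_filter.1 hm).2.sum_le
    have := (ih (fun i hi => hx i (hi.trans n.lt_succ_self)) m).mul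
      ((hx n n.lt_succ_self).pow (∑ i, l i - ∑ i, m i))
    rwa [one_mul, Nat.add_sub_cancel' hle] at this

theorem patternSum_eq_zero {R : Type*} [CommRing R] (x : ℕ → R) {n : ℕ} {l : Fin n → ℕ}
    (hl : ¬ Antitone l) : patternSum x n l = 0 := by
  rcases n with _ | n
  · exact absurd (fun i => i.elim0) hl
  · rw [patternSum, Finset.filter_false_of_mem, Finset.sum_empty]
    intro m _ hm
    exact hl (Fin.antitone_iff_succ_le.2 fun i => (hm i).1.trans (hm i).2)

section Tableaux

theorem mem_pcells {r : ℕ} {f : Fin r → ℕ} {p : Fin r × ℕ} : p ∈ pcells f ↔ p.2 < f p.1 := by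
  simp only [pcells, Finset.mem_filter, Finset.mem_product, Finset.mem_univ, true_and,
    Finset.mem_range, and_iff_right_iff_imp]
  exact fun h => h.trans_le (Finset.le_sup (Finset.mem_univ p.1))

theorem prod_pcells {r : ℕ} {R : Type*} [CommMonoid R] (f : Fin r → ℕ) (g : Fin r × ℕ → R) :
    ∏ c : {x // x ∈ pcells f}, g c = ∏ i, ∏ j ∈ Finset.range (f i), g (i, j) := by
  rw [Finset.prod_coe_sort (pcells f) g]
  exact Finset.prod_finset_product _ _ _ fun p => by simp [mem_pcells]

theorem IsSSYT.row_le {n : ℕ} {f : Fin (n + 1) → ℕ} (hf : Antitone f)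
    {T : {x // x ∈ pcells f} → Fin (n + 1)} (hT : IsSSYT f T) (a : Fin (n + 1)) (b : ℕ)
    (h : (a, b) ∈ pcells f) : a ≤ T ⟨(a, b), h⟩ := by
  induction a using Fin.induction with
  | zero => exact Fin.zero_le _
  | succ i ih =>
    have hi : (i.castSucc, b) ∈ pcells f :=
      mem_pcells.2 ((mem_pcells.1 h).trans_le (hf i.castSucc_lt_succ.le))
    have := hT.2 ⟨(i.castSucc, b), hi⟩ ⟨(i.succ, b), h⟩ rfl i.castSucc_lt_succ
    exact Fin.castSucc_lt_iff_succ_le.1 ((ih hi).trans_lt this)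

variable {n : ℕ} {f : Fin (n + 1) → ℕ}

/-- The shape formed by the entries of `T` other than the largest letter. -/
def innerShape (T : {x // x ∈ pcells f} → Fin (n + 1)) (i : Fin n) : ℕ :=
  sInf {j | ¬ ∃ h : (i.castSucc, j) ∈ pcells f, T ⟨(i.castSucc, j), h⟩ < Fin.last n}

theorem IsSSYT.lt_innerShape_iff {T : {x // x ∈ pcells f} → Fin (n + 1)} (hT : IsSSYT f T)
    (i : Fin n) (j : ℕ) : j < innerShape T i ↔
      ∃ h : (i.castSucc, j) ∈ pcells f, T ⟨(i.castSucc, j), h⟩ < Fin.last n := by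
  constructor
  · intro h
    exact not_not.1 (Nat.notMem_of_lt_sInf h)
  · rintro ⟨h, hlt⟩
    by_contra! hle
    have hne : {j | ¬ ∃ h : (i.castSucc, j) ∈ pcells f,
        T ⟨(i.castSucc, j), h⟩ < Fin.last n}.Nonempty :=
      ⟨f i.castSucc, fun ⟨h, _⟩ => (mem_pcells.1 h).ne rfl⟩
    have hc : (i.castSucc, innerShape T i) ∈ pcells f :=
      mem_pcells.2 (hle.trans_lt (mem_pcells.1 h))
    exact Nat.sInf_mem hne ⟨hc, (hT.1 ⟨_, hc⟩ ⟨_, h⟩ rfl hle).trans_lt hlt⟩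

theorem IsSSYT.interlaces_innerShape (hf : Antitone f) {T : {x // x ∈ pcells f} → Fin (n + 1)}
    (hT : IsSSYT f T) : Interlaces f (innerShape T) := by
  intro i
  constructor
  · refine le_of_forall_lt fun j hj => (hT.lt_innerShape_iff i j).2 ?_
    have hc : (i.castSucc, j) ∈ pcells f :=
      mem_pcells.2 (hj.trans_le (hf i.castSucc_lt_succ.le))
    exact ⟨hc, (hT.2 ⟨_, hc⟩ ⟨(i.succ, j), mem_pcells.2 hj⟩ rfl i.castSucc_lt_succ).trans_le
      (Fin.le_last _)⟩
  · refine le_of_forall_lt fun j hj => ?_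
    obtain ⟨h, -⟩ := (hT.lt_innerShape_iff i j).1 hj
    exact mem_pcells.1 h

/-- The tableau of shape `f` obtained from a tableau of shape `m` by adding the largest letter in
all cells outside `m`. -/
def extendTableau (f : Fin (n + 1) → ℕ) {m : Fin n → ℕ} (T : {x // x ∈ pcells m} → Fin n)
    (c : {x // x ∈ pcells f}) : Fin (n + 1) :=
  if h : ∃ hi : c.1.1.val < n, (⟨c.1.1, hi⟩, c.1.2) ∈ pcells m then
    (T ⟨_, h.2⟩).castSucc else Fin.last n

theorem extendTableau_castSucc {m : Fin n → ℕ} (T : {x // x ∈ pcells m} → Fin n) {i : Fin n}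
    {j : ℕ} (h : (i.castSucc, j) ∈ pcells f) (hm : (i, j) ∈ pcells m) :
    extendTableau f T ⟨(i.castSucc, j), h⟩ = (T ⟨(i, j), hm⟩).castSucc :=
  dif_pos (⟨i.2, hm⟩ : ∃ hi : i.castSucc.val < n, (⟨i.castSucc, hi⟩, j) ∈ pcells m)

theorem extendTableau_castSucc_of_notMem {m : Fin n → ℕ} (T : {x // x ∈ pcells m} → Fin n)
    {i : Fin n} {j : ℕ} (h : (i.castSucc, j) ∈ pcells f) (hm : (i, j) ∉ pcells m) :
    extendTableau f T ⟨(i.castSucc, j), h⟩ = Fin.last n :=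
  dif_neg fun h => hm h.2

theorem extendTableau_last {m : Fin n → ℕ} (T : {x // x ∈ pcells m} → Fin n) {j : ℕ}
    (h : (Fin.last n, j) ∈ pcells f) : extendTableau f T ⟨(Fin.last n, j), h⟩ = Fin.last n :=
  dif_neg fun h => h.1.ne rfl

theorem isSSYT_extendTableau (hf : Antitone f) {m : Fin n → ℕ} (hm : Interlaces f m)
    {T : {x // x ∈ pcells m} → Fin n} (hT : IsSSYT m T) : IsSSYT f (extendTableau f T) := by
  constructor
  · rintro ⟨⟨a, b⟩, hp⟩ ⟨⟨a', b'⟩, hq⟩ (rfl : a = a') (hb : b ≤ b')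
    induction a using Fin.lastCases with
    | last => rw [extendTableau_last T hq]; exact Fin.le_last _
    | cast i =>
      by_cases h : (i, b') ∈ pcells m
      · have h' : (i, b) ∈ pcells m := mem_pcells.2 (hb.trans_lt (mem_pcells.1 h))
        rw [extendTableau_castSucc T hp h', extendTableau_castSucc T hq h]
        exact Fin.castSucc_le_castSucc_iff.2 (hT.1 _ _ rfl hb)
      · rw [extendTableau_castSucc_of_notMem T hq h]
        exact Fin.le_last _
  · rintro ⟨⟨a, b⟩, hp⟩ ⟨⟨a', b'⟩, hq⟩ (rfl : b = b') (ha : a < a')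
    induction a using Fin.lastCases with
    | last => exact absurd ha (Fin.le_last _).not_gt
    | cast i =>
      have h : (i, b) ∈ pcells m :=
        mem_pcells.2 (((mem_pcells.1 hq).trans_le (hf (Fin.castSucc_lt_iff_succ_le.1 ha))).trans_le
          (hm i).1)
      rw [extendTableau_castSucc T hp h]
      induction a' using Fin.lastCases with
      | last => rw [extendTableau_last T hq]; exact Fin.castSucc_lt_last _
      | cast i' =>
        by_cases h' : (i', b) ∈ pcells m
        · rw [extendTableau_castSucc T hq h']
          exact Fin.castSucc_lt_castSucc_iff.2 (hT.2 _ _ rfl (Fin.castSucc_lt_castSucc_iff.1 ha))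
        · rw [extendTableau_castSucc_of_notMem T hq h']
          exact Fin.castSucc_lt_last _

theorem innerShape_extendTableau (hf : Antitone f) {m : Fin n → ℕ} (hm : Interlaces f m)
    {T : {x // x ∈ pcells m} → Fin n} (hT : IsSSYT m T) :
    innerShape (extendTableau f T) = m := by
  funext i
  refine eq_of_forall_lt_iff fun j => ?_
  rw [(isSSYT_extendTableau hf hm hT).lt_innerShape_iff]
  constructor
  · rintro ⟨h, hlt⟩
    by_contra hj
    rw [extendTableau_castSucc_of_notMem T h fun h => hj (mem_pcells.1 h)] at hlt
    exact hlt.ne rfl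
  · intro hj
    refine ⟨mem_pcells.2 (hj.trans_le (hm i).2), ?_⟩
    rw [extendTableau_castSucc T _ (mem_pcells.2 hj)]
    exact Fin.castSucc_lt_last _

theorem prod_extendTableau {R : Type*} [CommRing R] (x : ℕ → R) {m : Fin n → ℕ}
    (hm : Interlaces f m) (T : {x // x ∈ pcells m} → Fin n) :
    ∏ c, x (extendTableau f T c) = (∏ c, x (T c)) * x n ^ (∑ i, f i - ∑ i, m i) := by
  let g : Fin n × ℕ → R := fun p => if h : p ∈ pcells m then x (T ⟨p, h⟩) else x n
  let g' : Fin (n + 1) × ℕ → R := fun p => if hi : p.1.val < n then g (⟨p.1, hi⟩, p.2) else x n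
  have hg : ∀ c : {x // x ∈ pcells m}, x (T c) = g c := fun c => by simp [g]
  have hg' : ∀ c, x (extendTableau f T c) = g' c := by
    rintro ⟨⟨a, b⟩, hc⟩
    induction a using Fin.lastCases with
    | last => simp [extendTableau_last, g']
    | cast i =>
      by_cases h : (i, b) ∈ pcells m
      · simp [extendTableau_castSucc T hc h, g', g, h]
      · simp [extendTableau_castSucc_of_notMem T hc h, g', g, h]
  have hrow : ∀ i : Fin n, ∏ j ∈ Finset.range (f i.castSucc), g' (i.castSucc, j) =
      (∏ j ∈ Finset.range (m i), g (i, j)) * x n ^ (f i.castSucc - m i) := by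
    intro i
    rw [← Finset.prod_range_mul_prod_Ico _ (hm i).2]
    congr 1
    · exact Finset.prod_congr rfl fun j _ => by simp [g']
    · rw [← Nat.card_Ico, ← Finset.prod_const]
      refine Finset.prod_congr rfl fun j hj => ?_
      have : ¬ (i, j) ∈ pcells m := by
        rw [mem_pcells]
        exact (Finset.mem_Ico.1 hj).1.not_gt
      simp [g', g, this]
  rw [Finset.prod_congr rfl fun c _ => hg c, Finset.prod_congr rfl fun c _ => hg' c,
    prod_pcells m g, prod_pcells f g', Fin.prod_univ_castSucc, Finset.prod_congr rfl fun i _ => hrow i,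
    Finset.prod_mul_distrib, Finset.prod_pow_eq_pow_sum, mul_assoc]
  congr 1
  have : ∀ j ∈ Finset.range (f (Fin.last n)), g' (Fin.last n, j) = x n := by simp [g']
  rw [Finset.prod_congr rfl this, Finset.prod_const, Finset.card_range, ← pow_add,
    Fin.sum_univ_castSucc f]
  congr 1
  have : ∑ i : Fin n, (f i.castSucc - m i) + ∑ i, m i = ∑ i : Fin n, f i.castSucc := by
    rw [← Finset.sum_add_distrib]
    exact Finset.sum_congr rfl fun i _ => Nat.sub_add_cancel (hm i).2
  omega

theorem sum_innerShape_eq {R : Type*} [CommRing R] (x : ℕ → R) (hf : Antitone f) {m : Fin n → ℕ}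
    (hm : Interlaces f m) :
    ∑ T ∈ (Finset.univ.filter fun T : {x // x ∈ pcells f} → Fin (n + 1) => IsSSYT f T).filter
        (fun T => innerShape T = m), ∏ c, x (T c) =
      (∑ T ∈ Finset.univ.filter fun T : {x // x ∈ pcells m} → Fin n => IsSSYT m T,
        ∏ c, x (T c)) * x n ^ (∑ i, f i - ∑ i, m i) := by
  rw [Finset.sum_mul]
  symm
  refine Finset.sum_bij (fun T _ => extendTableau f T) ?_ ?_ ?_ ?_
  · intro T hT
    simp only [Finset.mem_filter, Finset.mem_univ, true_and] at hT ⊢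
    exact ⟨isSSYT_extendTableau hf hm hT, innerShape_extendTableau hf hm hT⟩
  · intro T _ T' _ h
    funext ⟨⟨i, j⟩, hc⟩
    have hc' : (i.castSucc, j) ∈ pcells f :=
      mem_pcells.2 ((mem_pcells.1 hc).trans_le (hm i).2)
    have := congrFun h ⟨_, hc'⟩
    rw [extendTableau_castSucc T hc' hc, extendTableau_castSucc T' hc' hc] at this
    exact Fin.castSucc_injective n this
  · intro T hT
    simp only [Finset.mem_filter, Finset.mem_univ, true_and] at hT
    obtain ⟨hT, rfl⟩ := hT
    have hmem : ∀ c : {x // x ∈ pcells (innerShape T)},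
        ∃ h : (c.1.1.castSucc, c.1.2) ∈ pcells f, T ⟨_, h⟩ < Fin.last n := fun c =>
      (hT.lt_innerShape_iff _ _).1 (mem_pcells.1 c.2)
    refine ⟨fun c => (T ⟨_, (hmem c).1⟩).castLT (hmem c).2, ?_, ?_⟩
    · simp only [Finset.mem_filter, Finset.mem_univ, true_and]
      exact ⟨fun p q h h' => hT.1 _ _ (congrArg Fin.castSucc h) h',
        fun p q h h' => hT.2 _ _ h (Fin.castSucc_lt_castSucc_iff.2 h')⟩
    · funext ⟨⟨a, b⟩, hc⟩
      induction a using Fin.lastCases with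
      | last =>
        rw [extendTableau_last]
        exact (Fin.last_le_iff.1 (hT.row_le hf _ _ hc)).symm
      | cast i =>
        by_cases h : (i, b) ∈ pcells (innerShape T)
        · rw [extendTableau_castSucc _ hc h, Fin.castSucc_castLT]
        · rw [extendTableau_castSucc_of_notMem _ hc h]
          by_contra hne
          exact h (mem_pcells.2 ((hT.lt_innerShape_iff _ _).2
            ⟨hc, Fin.lt_last_iff_ne_last.2 (Ne.symm hne)⟩))
  · intro T _
    exact (prod_extendTableau x hm T).symm

end Tableaux

theorem sum_isSSYT_eq_patternSum {R : Type*} [CommRing R] (x : ℕ → R) {n : ℕ} {f : Fin n → ℕ}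
    (hf : Antitone f) :
    ∑ T ∈ Finset.univ.filter fun T : {x // x ∈ pcells f} → Fin n => IsSSYT f T,
      ∏ c, x (T c) = patternSum x n f := by
  induction n with
  | zero =>
    have : IsEmpty {x // x ∈ pcells f} := ⟨fun c => c.1.1.elim0⟩
    rw [Finset.filter_true_of_mem fun T _ => ⟨fun p => isEmptyElim p, fun p => isEmptyElim p⟩]
    simp [patternSum]
  | succ n ih =>
    rw [patternSum, ← Finset.sum_fiberwise_of_maps_to
      (t := (box n (∑ i, f i + 1)).filter (Interlaces f)) (g := innerShape)]
    · refine Finset.sum_congr rfl fun m hm => ?_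
      have hm := (Finset.mem_filter.1 hm).2
      rw [sum_innerShape_eq x hf hm, ih]
      rcases n with _ | n
      · exact fun i => i.elim0
      · exact Fin.antitone_iff_succ_le.2 fun i => (hm i.succ).2.trans (hm i.castSucc).1
    · intro T hT
      have := (Finset.mem_filter.1 hT).2.interlaces_innerShape hf
      rw [Finset.mem_filter, mem_box]
      exact ⟨Nat.lt_succ_of_le this.sum_le, this⟩

theorem schurPoly_eq_patternSum {n : ℕ} {f : Fin n → ℕ} (hf : Antitone f) :
    schurPoly f n = patternSum (fun i => if h : i < n then MvPolynomial.X ⟨i, h⟩ else 0) n f := by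
  rw [← sum_isSSYT_eq_patternSum _ hf, schurPoly]
  simp

theorem gradingHom_eq_mk_totalSum {n : ℕ} {g : MvPowerSeries (Fin n) ℤ}
    (hg : ∀ d, MvPowerSeries.coeff d g =
      ∑ κ ∈ partitionsLE n (∑ i, d i), MvPolynomial.coeff d (schurPoly κ n)) :
    gradingHom g =
      PowerSeries.mk (totalSum
        (fun i => if h : i < n then (MvPowerSeries.X ⟨i, h⟩ : MvPowerSeries (Fin n) ℤ) else 0) n) := by
  let x : ℕ → MvPolynomial (Fin n) ℤ := fun i => if h : i < n then MvPolynomial.X ⟨i, h⟩ else 0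
  have hx : (fun i => if h : i < n then (MvPowerSeries.X ⟨i, h⟩ : MvPowerSeries (Fin n) ℤ) else 0) =
      fun i => MvPolynomial.coeToMvPowerSeries.ringHom (x i) := by
    funext i
    simp only [x]
    split_ifs <;> simp
  have hhom : ∀ l, (patternSum x n l).IsHomogeneous (∑ i, l i) :=
    isHomogeneous_patternSum fun i hi => by
      simpa [x, hi] using MvPolynomial.isHomogeneous_X ℤ _
  ext m d
  simp only [hx, totalSum, PowerSeries.coeff_mk, map_sum, gradingHom, RingHom.coe_mk,
    MonoidHom.coe_mk, OneHom.coe_mk, MvPowerSeries.coeff_homogeneousComponent, hg]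
  have hcoe : ∀ l, MvPowerSeries.coeff d
      (patternSum (fun i => MvPolynomial.coeToMvPowerSeries.ringHom (x i)) n l) =
        MvPolynomial.coeff d (patternSum x n l) := fun l => by
    rw [← map_patternSum, MvPolynomial.coeToMvPowerSeries.ringHom_apply, MvPolynomial.coeff_coe]
  simp only [hcoe]
  split_ifs with hd
  · have hdeg : ∑ i, d i = m := by rw [← hd, Finsupp.degree_eq_sum]
    have hanti : ∀ κ ∈ partitionsLE n (∑ i, d i), Antitone κ := fun κ hκ =>
      (Finset.mem_filter.1 hκ).2.1
    rw [Finset.sum_congr rfl fun κ hκ => by rw [schurPoly_eq_patternSum (hanti κ hκ)], hdeg,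
      ← Finset.sum_filter_of_ne (s := compositions n m) (p := Antitone),
      ← Finset.sum_filter_of_ne (s := partitionsLE n m) (p := fun κ => ∑ i, κ i = m)]
    · refine Finset.sum_congr (Finset.ext fun κ => ?_) fun _ _ => rfl
      simp only [partitionsLE, Finset.mem_filter, Fintype.mem_piFinset, Finset.mem_range,
        mem_compositions]
      constructor
      · rintro ⟨⟨-, h, -⟩, h'⟩
        exact ⟨h', h⟩
      · rintro ⟨rfl, h⟩
        exact ⟨⟨fun i => Nat.lt_succ_of_le (Finset.single_le_sum (fun _ _ => Nat.zero_le _)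
          (Finset.mem_univ i)), h, le_rfl⟩, rfl⟩
    · intro κ _ hne
      by_contra h
      exact hne ((hhom κ).coeff_eq_zero (by rw [hd]; exact Ne.symm h))
    · intro κ _ hne
      by_contra h
      exact hne (by rw [patternSum_eq_zero x h, MvPolynomial.coeff_zero])
  · refine (Finset.sum_eq_zero fun κ hκ => (hhom κ).coeff_eq_zero ?_).symm
    rwa [mem_compositions.1 hκ]

/-- Littlewood's identity:
`Σ_λ s_λ(q_1,…,q_n) = 1/(∏_{i=1}^n (1 - q_i) · ∏_{1 ≤ i < j ≤ n} (1 - q_i q_j))`,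
stated as: the formal power series whose coefficients are those of the sum of the Schur
polynomials `s_λ(q_1,…,q_n)` over all partitions `λ` with at most `n` parts is the
inverse of `∏_i (1 - q_i) ∏_{i<j} (1 - q_i q_j)`. -/
theorem littlewood_identity (n : ℕ) :
    ((∏ i : Fin n, (1 - MvPowerSeries.X i : MvPowerSeries (Fin n) ℤ)) *
        ∏ p ∈ Finset.univ.filter (fun p : Fin n × Fin n => p.1 < p.2),
          (1 - MvPowerSeries.X p.1 * MvPowerSeries.X p.2 : MvPowerSeries (Fin n) ℤ)) *
      (show MvPowerSeries (Fin n) ℤ from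
        fun d => ∑ κ ∈ partitionsLE n (∑ i, d i),
          MvPolynomial.coeff d (schurPoly κ n)) = 1 := by
  suffices ∀ g : MvPowerSeries (Fin n) ℤ, (∀ d, MvPowerSeries.coeff d g =
      ∑ κ ∈ partitionsLE n (∑ i, d i), MvPolynomial.coeff d (schurPoly κ n)) →
      ((∏ i : Fin n, (1 - MvPowerSeries.X i : MvPowerSeries (Fin n) ℤ)) *
        ∏ p ∈ Finset.univ.filter (fun p : Fin n × Fin n => p.1 < p.2),
          (1 - MvPowerSeries.X p.1 * MvPowerSeries.X p.2 : MvPowerSeries (Fin n) ℤ)) * g = 1 from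
    this _ fun _ => rfl
  intro g hg
  apply gradingHom_injective
  rw [map_mul, gradingHom_eq_mk_totalSum hg, map_mul, map_prod, map_prod, map_one,
    ← prod_mul_mk_totalSum (fun i => if h : i < n then
      (MvPowerSeries.X ⟨i, h⟩ : MvPowerSeries (Fin n) ℤ) else 0) n]
  congr 2
  · rw [Finset.prod_range]
    simp [gradingHom_X]
  · rw [Finset.prod_range, Finset.prod_filter, Fintype.prod_prod_type_right]
    refine Finset.prod_congr rfl fun j _ => ?_
    rw [← Finset.prod_filter]
    refine Finset.prod_bij (fun i _ => i.val) ?_ ?_ ?_ ?_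
    · intro i hi
      simpa using hi
    · exact fun i _ i' _ h => Fin.ext h
    · intro i hi
      rw [Finset.mem_range] at hi
      exact ⟨⟨i, hi.trans j.2⟩, Finset.mem_filter.2 ⟨Finset.mem_univ _, hi⟩, rfl⟩
    · intro i _
      rw [map_sub, map_one, map_mul, gradingHom_X, gradingHom_X, dif_pos i.2, dif_pos j.2, map_mul]
      ring

end
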